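/- Let p ∈ [1,∞] and q⃗ = (q₁,q₂,q₃) with 1 < q_j < ∞ for each j, set α := 2/(2/p + 1/q̄) where 1/q̄ := 1/q₁+1/q₂+1/q₃, and assume α > 1, q_j ≤ 2α/(α−1) for each j, and 7 − 3α − 4α/p ≥ 0. There exists a constant C, depending only on p and q⃗, such that for all 0 < ξ < η, with ϱ := (ξ+3η)/4, and every u : ℝ³×(−η²,0) → ℝ³ smooth in the spatial variable: ‖u‖_{L³(Q(ϱ))}³ ≤ C η^{3(α−1)/2} ‖u‖_{L^p_t L^{q⃗}_x(Q(η))}^{α} { [1 + η^{(7−3α−4α/p)/2}/(η−ϱ)^{(7−3α−4α/p)/2}] ‖u‖_{L^∞_t L²_x(Q(η))}^{3−α} + ‖∇u‖_{L²(Q(η))}^{3−α} }. -/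

import Mathlib

open MeasureTheory ENNReal Set Metric Filter

noncomputable section

/-- Euclidean 3-space. -/
abbrev E3 : Type := EuclideanSpace ℝ (Fin 3)

/-- The point (x₁,x₂,x₃) of ℝ³. -/
def pt3 (x1 x2 x3 : ℝ) : E3 := (WithLp.equiv 2 (Fin 3 → ℝ)).symm ![x1, x2, x3]

/-- Anisotropic Lebesgue (quasi-)norm `‖f‖_{L^{q⃗}(Ω)}` with finite exponents:
iterated L^{q₁}, L^{q₂}, L^{q₃} norms in x₁, x₂, x₃ of f extended by 0 outside Ω. -/
def anisoNorm (q1 q2 q3 : ℝ) (Ω : Set E3) (f : E3 → ℝ) : ℝ≥0∞ :=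
  (∫⁻ x3 : ℝ, (∫⁻ x2 : ℝ, (∫⁻ x1 : ℝ,
      (ENNReal.ofReal |Ω.indicator f (pt3 x1 x2 x3)|) ^ q1) ^ (q2 / q1)) ^ (q3 / q2)) ^ (1 / q3)

/-- Partial derivative in the i-th coordinate direction. -/
def pd (i : Fin 3) (f : E3 → ℝ) (x : E3) : ℝ := fderiv ℝ f x (EuclideanSpace.single i 1)

/-- Laplacian. -/
def lap (f : E3 → ℝ) (x : E3) : ℝ := ∑ i : Fin 3, pd i (fun y => pd i f y) x

/-- Mixed norm `‖f‖_{L^p_t L^{q⃗}_x(Q(r))}`, time exponent `p ∈ [1,∞]`,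
where `Q(r) = B(r) × (−r²,0)`. -/
def mixedNorm (p : ℝ≥0∞) (q1 q2 q3 r : ℝ) (f : E3 → ℝ → ℝ) : ℝ≥0∞ :=
  if p = ∞ then
    essSup (fun t => anisoNorm q1 q2 q3 (ball (0 : E3) r) (fun x => f x t))
      (volume.restrict (Ioo (-(r^2)) 0))
  else
    (∫⁻ t in Ioo (-(r^2)) 0,
        (anisoNorm q1 q2 q3 (ball (0 : E3) r) (fun x => f x t)) ^ p.toReal) ^ (1 / p.toReal)

/-- `L²` norm of a scalar function over a set. -/
def l2On (s : Set E3) (g : E3 → ℝ) : ℝ≥0∞ :=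
  (∫⁻ x in s, (ENNReal.ofReal |g x|) ^ 2) ^ ((1:ℝ)/2)

lemma hold4 {f0 f1 f2 f3 : ℝ → ℝ≥0∞} (h0 : Measurable f0) (h1 : Measurable f1)
    (h2 : Measurable f2) (h3 : Measurable f3) {p0 p1 p2 p3 : ℝ} (n0 : 0 ≤ p0) (n1 : 0 ≤ p1)
    (n2 : 0 ≤ p2) (n3 : 0 ≤ p3) (hs : p0 + p1 + p2 + p3 = 1) (K : ℝ≥0∞) :
    ∫⁻ a, K * (f0 a ^ p0 * f1 a ^ p1 * f2 a ^ p2 * f3 a ^ p3) ≤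
      K * ((∫⁻ a, f0 a) ^ p0 * (∫⁻ a, f1 a) ^ p1 * (∫⁻ a, f2 a) ^ p2 * (∫⁻ a, f3 a) ^ p3) := by
  rw [lintegral_const_mul _ (by fun_prop)]
  gcongr
  have := ENNReal.lintegral_prod_norm_pow_le (μ := (volume : Measure ℝ)) (Finset.univ : Finset (Fin 4))
    (f := ![f0, f1, f2, f3]) (p := ![p0, p1, p2, p3])
    (by intro i _; fin_cases i <;> simp <;> fun_prop)
    (by simp [Fin.sum_univ_four]; linarith)
    (by intro i _; fin_cases i <;> simp <;> assumption)
  simpa [Fin.prod_univ_four] using this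

lemma core_holder (f h : ℝ → ℝ → ℝ → ℝ≥0∞)
    (hf : Measurable (fun z : ℝ × ℝ × ℝ => f z.1 z.2.1 z.2.2))
    (hh : Measurable (fun z : ℝ × ℝ × ℝ => h z.1 z.2.1 z.2.2))
    {A m c1 c2 c3 q1 q2 q3 : ℝ} (hA : 0 ≤ A) (hm : 0 ≤ m) (hc1 : 0 ≤ c1) (hc2 : 0 ≤ c2)
    (hc3 : 0 ≤ c3) (hq1 : 0 < q1) (hq2 : 0 < q2) (hq3 : 0 < q3)
    (e1 : A / q1 + m + c2 + c3 = 1) (e2 : A / q2 + m + c1 + c3 = 1)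
    (e3 : A / q3 + m + c1 + c2 = 1) :
    ∫⁻ x3, ∫⁻ x2, ∫⁻ x1, (∫⁻ y, h y x2 x3) ^ c1 * ((f x1 x2 x3 ^ q1) ^ (A / q1) *
        (f x1 x2 x3 ^ 2) ^ m * (∫⁻ y, h x1 y x3) ^ c2 * (∫⁻ y, h x1 x2 y) ^ c3) ≤
      ((∫⁻ x3, (∫⁻ x2, (∫⁻ x1, f x1 x2 x3 ^ q1) ^ (q2 / q1)) ^ (q3 / q2)) ^ (1 / q3)) ^ A *
      (∫⁻ x3, ∫⁻ x2, ∫⁻ x1, f x1 x2 x3 ^ 2) ^ m *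
      (∫⁻ x3, ∫⁻ x2, ∫⁻ x1, h x1 x2 x3) ^ (c1 + c2 + c3) := by
  have hf3 : ∀ x2 x3, Measurable (fun x1 => f x1 x2 x3) := fun x2 x3 =>
    hf.comp (f := fun x1 : ℝ => (x1, x2, x3)) (by fun_prop)
  -- measurability of the partial integrals
  have mF : Measurable (fun z : ℝ × ℝ => ∫⁻ x1, f x1 z.1 z.2 ^ q1) :=
    Measurable.lintegral_prod_right (f := fun (z : ℝ × ℝ) x1 => f x1 z.1 z.2 ^ q1)
      ((hf.comp (f := fun w : (ℝ × ℝ) × ℝ => (w.2, w.1.1, w.1.2)) (by fun_prop)).pow_const q1)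
  have mM : Measurable (fun z : ℝ × ℝ => ∫⁻ x1, f x1 z.1 z.2 ^ 2) :=
    Measurable.lintegral_prod_right (f := fun (z : ℝ × ℝ) x1 => f x1 z.1 z.2 ^ 2)
      ((hf.comp (f := fun w : (ℝ × ℝ) × ℝ => (w.2, w.1.1, w.1.2)) (by fun_prop)).pow_const 2)
  have m1 : Measurable (fun z : ℝ × ℝ => ∫⁻ y, h y z.1 z.2) :=
    Measurable.lintegral_prod_right (f := fun (z : ℝ × ℝ) y => h y z.1 z.2)
      (hh.comp (f := fun w : (ℝ × ℝ) × ℝ => (w.2, w.1.1, w.1.2)) (by fun_prop))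
  have m2 : Measurable (fun z : ℝ × ℝ => ∫⁻ y, h z.1 y z.2) :=
    Measurable.lintegral_prod_right (f := fun (z : ℝ × ℝ) y => h z.1 y z.2)
      (hh.comp (f := fun w : (ℝ × ℝ) × ℝ => (w.1.1, w.2, w.1.2)) (by fun_prop))
  have m3 : Measurable (fun z : ℝ × ℝ => ∫⁻ y, h z.1 z.2 y) :=
    Measurable.lintegral_prod_right (f := fun (z : ℝ × ℝ) y => h z.1 z.2 y)
      (hh.comp (f := fun w : (ℝ × ℝ) × ℝ => (w.1.1, w.1.2, w.2)) (by fun_prop))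
  have m31 : Measurable (fun x2 : ℝ => ∫⁻ x1, ∫⁻ y, h x1 x2 y) :=
    Measurable.lintegral_prod_right (f := fun (x2 : ℝ) x1 => ∫⁻ y, h x1 x2 y)
      (m3.comp (f := fun w : ℝ × ℝ => (w.2, w.1)) (by fun_prop))
  have m21 : Measurable (fun x3 : ℝ => ∫⁻ x1, ∫⁻ y, h x1 y x3) :=
    Measurable.lintegral_prod_right (f := fun (x3 : ℝ) x1 => ∫⁻ y, h x1 y x3)
      (m2.comp (f := fun w : ℝ × ℝ => (w.2, w.1)) (by fun_prop))
  have m11 : Measurable (fun x3 : ℝ => ∫⁻ x2, ∫⁻ y, h y x2 x3) :=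
    Measurable.lintegral_prod_right (f := fun (x3 : ℝ) x2 => ∫⁻ y, h y x2 x3)
      (m1.comp (f := fun w : ℝ × ℝ => (w.2, w.1)) (by fun_prop))
  have mM1 : Measurable (fun x3 : ℝ => ∫⁻ x2, ∫⁻ x1, f x1 x2 x3 ^ 2) :=
    Measurable.lintegral_prod_right (f := fun (x3 : ℝ) x2 => ∫⁻ x1, f x1 x2 x3 ^ 2)
      (mM.comp (f := fun w : ℝ × ℝ => (w.2, w.1)) (by fun_prop))
  have mF1 : Measurable (fun x3 : ℝ => ∫⁻ x2, (∫⁻ x1, f x1 x2 x3 ^ q1) ^ (q2 / q1)) :=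
    Measurable.lintegral_prod_right (f := fun (x3 : ℝ) x2 => (∫⁻ x1, f x1 x2 x3 ^ q1) ^ (q2 / q1))
      ((mF.comp (f := fun w : ℝ × ℝ => (w.2, w.1)) (by fun_prop)).pow_const _)
  -- first variable
  have s1 : ∀ x2 x3, ∫⁻ x1, (∫⁻ y, h y x2 x3) ^ c1 * ((f x1 x2 x3 ^ q1) ^ (A / q1) *
        (f x1 x2 x3 ^ 2) ^ m * (∫⁻ y, h x1 y x3) ^ c2 * (∫⁻ y, h x1 x2 y) ^ c3) ≤
      (∫⁻ x1, ∫⁻ y, h x1 y x3) ^ c2 * (((∫⁻ x1, f x1 x2 x3 ^ q1) ^ (q2 / q1)) ^ (A / q2) *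
        (∫⁻ x1, f x1 x2 x3 ^ 2) ^ m * (∫⁻ y, h y x2 x3) ^ c1 * (∫⁻ x1, ∫⁻ y, h x1 x2 y) ^ c3) := by
    intro x2 x3
    refine (hold4 ((hf3 x2 x3).pow_const q1) ((hf3 x2 x3).pow_const 2)
      (m2.comp (f := fun x1 : ℝ => (x1, x3)) (by fun_prop))
      (m3.comp (f := fun x1 : ℝ => (x1, x2)) (by fun_prop))
      (by positivity) hm hc2 hc3 e1 _).trans (le_of_eq ?_)
    rw [← ENNReal.rpow_mul]
    have : q2 / q1 * (A / q2) = A / q1 := by field_simp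
    rw [this]
    simp only [Function.comp_apply]
    ring
  have s2 : ∀ x3, ∫⁻ x2, (∫⁻ x1, ∫⁻ y, h x1 y x3) ^ c2 *
        (((∫⁻ x1, f x1 x2 x3 ^ q1) ^ (q2 / q1)) ^ (A / q2) *
        (∫⁻ x1, f x1 x2 x3 ^ 2) ^ m * (∫⁻ y, h y x2 x3) ^ c1 * (∫⁻ x1, ∫⁻ y, h x1 x2 y) ^ c3) ≤
      (∫⁻ x2, ∫⁻ x1, ∫⁻ y, h x1 x2 y) ^ c3 *
        (((∫⁻ x2, (∫⁻ x1, f x1 x2 x3 ^ q1) ^ (q2 / q1)) ^ (q3 / q2)) ^ (A / q3) *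
        (∫⁻ x2, ∫⁻ x1, f x1 x2 x3 ^ 2) ^ m * (∫⁻ x2, ∫⁻ y, h y x2 x3) ^ c1 *
        (∫⁻ x1, ∫⁻ y, h x1 y x3) ^ c2) := by
    intro x3
    refine (hold4 ((mF.comp (f := fun x2 : ℝ => (x2, x3)) (by fun_prop)).pow_const (q2 / q1))
      (mM.comp (f := fun x2 : ℝ => (x2, x3)) (by fun_prop))
      (m1.comp (f := fun x2 : ℝ => (x2, x3)) (by fun_prop)) m31
      (by positivity) hm hc1 hc3 e2 _).trans (le_of_eq ?_)
    rw [← ENNReal.rpow_mul _ (q3 / q2)]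
    have : q3 / q2 * (A / q3) = A / q2 := by field_simp
    rw [this]
    simp only [Function.comp_apply]
    ring
  have t2 : ∫⁻ x3, ∫⁻ x1, ∫⁻ y, h x1 y x3 = ∫⁻ x3, ∫⁻ x2, ∫⁻ x1, h x1 x2 x3 := by
    refine lintegral_congr fun x3 => ?_
    exact lintegral_lintegral_swap (f := fun x1 x2 => h x1 x2 x3)
      (hh.comp (f := fun w : ℝ × ℝ => (w.1, w.2, x3)) (by fun_prop)).aemeasurable
  have t3 : ∫⁻ x2, ∫⁻ x1, ∫⁻ y, h x1 x2 y = ∫⁻ x3, ∫⁻ x2, ∫⁻ x1, h x1 x2 x3 := by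
    rw [lintegral_lintegral_swap (f := fun x3 x2 => ∫⁻ x1, h x1 x2 x3)
      (m1.comp (f := fun w : ℝ × ℝ => (w.2, w.1)) (by fun_prop)).aemeasurable]
    refine lintegral_congr fun x2 => ?_
    exact lintegral_lintegral_swap (f := fun x1 x3 => h x1 x2 x3)
      (hh.comp (f := fun w : ℝ × ℝ => (w.1, x2, w.2)) (by fun_prop)).aemeasurable
  calc _ ≤ ∫⁻ x3, ∫⁻ x2, (∫⁻ x1, ∫⁻ y, h x1 y x3) ^ c2 *
        (((∫⁻ x1, f x1 x2 x3 ^ q1) ^ (q2 / q1)) ^ (A / q2) *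
        (∫⁻ x1, f x1 x2 x3 ^ 2) ^ m * (∫⁻ y, h y x2 x3) ^ c1 * (∫⁻ x1, ∫⁻ y, h x1 x2 y) ^ c3) :=
        lintegral_mono fun x3 => lintegral_mono fun x2 => s1 x2 x3
    _ ≤ _ := lintegral_mono fun x3 => s2 x3
    _ ≤ _ := hold4 (mF1.pow_const _) mM1 m11 m21 (by positivity) hm hc1 hc2 e3 _
    _ = _ := by
      rw [t2, t3, ENNReal.rpow_add_of_nonneg _ _ (by positivity) hc3,
        ENNReal.rpow_add_of_nonneg _ _ hc1 hc2, ← ENNReal.rpow_mul _ (1 / q3)]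
      have : 1 / q3 * A = A / q3 := by ring
      rw [this]
      ring

lemma lintegral_E3 (F : E3 → ℝ≥0∞) (hF : Measurable F) :
    ∫⁻ x, F x = ∫⁻ x3, ∫⁻ x2, ∫⁻ x1, F (pt3 x1 x2 x3) := by
  rw [← (PiLp.volume_preserving_toLp (Fin 3)).lintegral_comp hF]
  have hm : Measurable fun a => F (WithLp.toLp 2 a) :=
    hF.comp (PiLp.volume_preserving_toLp (Fin 3)).measurable
  rw [← ((volume_preserving_piFinSuccAbove (fun _ : Fin 3 => ℝ) 2).symm _).lintegral_comp hm]
  rw [Measure.volume_eq_prod, lintegral_prod _ (by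
    apply Measurable.aemeasurable
    exact hm.comp (MeasurableEquiv.measurable _))]
  refine lintegral_congr fun x3 => ?_
  have hm2 : Measurable fun b : Fin 2 → ℝ => F (WithLp.toLp 2
      ((MeasurableEquiv.piFinSuccAbove (fun _ : Fin 3 => ℝ) 2).symm (x3, b))) :=
    (hm.comp (MeasurableEquiv.measurable _)).comp (by fun_prop)
  rw [← ((volume_preserving_finTwoArrow ℝ).symm _).lintegral_comp hm2]
  rw [Measure.volume_eq_prod, lintegral_prod_symm _ (by
    apply Measurable.aemeasurable
    exact hm2.comp (MeasurableEquiv.measurable _))]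
  refine lintegral_congr fun x2 => lintegral_congr fun x1 => ?_
  congr 1
  ext i
  fin_cases i <;> rfl

lemma measurable_pt3 : Measurable (fun z : ℝ × ℝ × ℝ => pt3 z.1 z.2.1 z.2.2) := by
  have : Measurable (fun z : ℝ × ℝ × ℝ => (![z.1, z.2.1, z.2.2] : Fin 3 → ℝ)) := by
    rw [measurable_pi_iff]
    intro i
    fin_cases i <;> simp <;> fun_prop
  exact (PiLp.volume_preserving_toLp (Fin 3)).measurable.comp this

lemma spatial_abs (V g : E3 → ℝ≥0∞) (hV : Measurable V) (hg : Measurable g)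
    {α a b c1 c2 c3 q1 q2 q3 : ℝ} (hα : 0 ≤ α) (ha : 0 ≤ a) (hc1 : 0 ≤ c1) (hc2 : 0 ≤ c2)
    (hc3 : 0 ≤ c3) (hq1 : 0 < q1) (hq2 : 0 < q2) (hq3 : 0 < q3)
    (hb : b = c1 + c2 + c3) (hab : a + b = 3 - α)
    (e1 : c1 = α / q1 - (α - 1) / 2) (e2 : c2 = α / q2 - (α - 1) / 2)
    (e3 : c3 = α / q3 - (α - 1) / 2) (K : ℝ≥0∞)
    (hK : K ≠ ∞) (p1 : ∀ x1 x2 x3, V (pt3 x1 x2 x3) ^ (5 / 2 : ℝ) ≤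
      K * ∫⁻ y, V (pt3 y x2 x3) ^ (3 / 2 : ℝ) * g (pt3 y x2 x3))
    (p2 : ∀ x1 x2 x3, V (pt3 x1 x2 x3) ^ (5 / 2 : ℝ) ≤
      K * ∫⁻ y, V (pt3 x1 y x3) ^ (3 / 2 : ℝ) * g (pt3 x1 y x3))
    (p3 : ∀ x1 x2 x3, V (pt3 x1 x2 x3) ^ (5 / 2 : ℝ) ≤
      K * ∫⁻ y, V (pt3 x1 x2 y) ^ (3 / 2 : ℝ) * g (pt3 x1 x2 y))
    (hN : ∫⁻ x, V x ^ 3 ≠ ∞) :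
    ∫⁻ x, V x ^ 3 ≤ K ^ b *
      ((∫⁻ x3, (∫⁻ x2, (∫⁻ x1, V (pt3 x1 x2 x3) ^ q1) ^ (q2 / q1)) ^ (q3 / q2)) ^ (1 / q3)) ^ α *
      (∫⁻ x, V x ^ 2) ^ (a / 2) * (∫⁻ x, g x ^ 2) ^ (b / 2) := by
  have hb0 : 0 ≤ b := by rw [hb]; positivity
  set l : ℝ := 1 / (1 + b / 2) with hl
  have hl0 : 0 < l := by positivity
  have hl1 : l * (1 + b / 2) = 1 := by rw [hl]; field_simp
  set N := ∫⁻ x, V x ^ 3 with hNdef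
  set A := (∫⁻ x3, (∫⁻ x2, (∫⁻ x1, V (pt3 x1 x2 x3) ^ q1) ^ (q2 / q1)) ^ (q3 / q2)) ^ (1 / q3)
    with hAdef
  set M := ∫⁻ x, V x ^ 2 with hMdef
  set G := ∫⁻ x, g x ^ 2 with hGdef
  let f : ℝ → ℝ → ℝ → ℝ≥0∞ := fun x1 x2 x3 => V (pt3 x1 x2 x3)
  let h : ℝ → ℝ → ℝ → ℝ≥0∞ := fun x1 x2 x3 => V (pt3 x1 x2 x3) ^ (3 / 2 : ℝ) * g (pt3 x1 x2 x3)
  have hVm : Measurable fun x => V x ^ (3 / 2 : ℝ) * g x := (hV.pow_const _).mul hg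
  have key := core_holder f h (hV.comp measurable_pt3) (hVm.comp measurable_pt3)
    (A := l * α) (m := l * (a / 2)) (c1 := l * c1) (c2 := l * c2) (c3 := l * c3)
    (q1 := q1) (q2 := q2) (q3 := q3) (by positivity) (by positivity) (by positivity) (by positivity)
    (by positivity) hq1 hq2 hq3
    (by
      rw [← hl1, mul_div_assoc, show α / q1 = c1 + (α - 1) / 2 by rw [e1]; ring, hb]
      have : a = 3 - α - (c1 + c2 + c3) := by linarith
      rw [this]; ring)
    (by
      rw [← hl1, mul_div_assoc, show α / q2 = c2 + (α - 1) / 2 by rw [e2]; ring, hb]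
      have : a = 3 - α - (c1 + c2 + c3) := by linarith
      rw [this]; ring)
    (by
      rw [← hl1, mul_div_assoc, show α / q3 = c3 + (α - 1) / 2 by rw [e3]; ring, hb]
      have : a = 3 - α - (c1 + c2 + c3) := by linarith
      rw [this]; ring)
  have hE : ∫⁻ x3, ∫⁻ x2, ∫⁻ x1, h x1 x2 x3 ≤ N ^ (1 / 2 : ℝ) * G ^ (1 / 2 : ℝ) := by
    rw [← lintegral_E3 _ hVm]
    refine le_trans (le_of_eq ?_) (ENNReal.lintegral_mul_norm_pow_le (hV.pow_const 3).aemeasurable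
      (hg.pow_const 2).aemeasurable (by norm_num : (0 : ℝ) ≤ 1 / 2) (by norm_num : (0 : ℝ) ≤ 1 / 2)
      (by norm_num))
    refine lintegral_congr fun x => ?_
    rw [← ENNReal.rpow_natCast, ← ENNReal.rpow_natCast, ← ENNReal.rpow_mul, ← ENNReal.rpow_mul]
    norm_num
  have hM : ∫⁻ x3, ∫⁻ x2, ∫⁻ x1, f x1 x2 x3 ^ 2 = M := by
    rw [hMdef, lintegral_E3 _ (hV.pow_const 2)]
  have hpt : ∀ x1 x2 x3, V (pt3 x1 x2 x3) ^ 3 ≤ K ^ (l * b) *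
      ((∫⁻ y, h y x2 x3) ^ (l * c1) * ((f x1 x2 x3 ^ q1) ^ (l * α / q1) *
        (f x1 x2 x3 ^ 2) ^ (l * (a / 2)) * (∫⁻ y, h x1 y x3) ^ (l * c2) *
        (∫⁻ y, h x1 x2 y) ^ (l * c3))) := by
    intro x1 x2 x3
    have k1 := ENNReal.rpow_le_rpow (p1 x1 x2 x3) (by positivity : 0 ≤ l * c1)
    have k2 := ENNReal.rpow_le_rpow (p2 x1 x2 x3) (by positivity : 0 ≤ l * c2)
    have k3 := ENNReal.rpow_le_rpow (p3 x1 x2 x3) (by positivity : 0 ≤ l * c3)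
    rw [ENNReal.mul_rpow_of_nonneg _ _ (by positivity)] at k1 k2 k3
    have hd : V (pt3 x1 x2 x3) ^ 3 = (V (pt3 x1 x2 x3) ^ (5 / 2 : ℝ)) ^ (l * c1) *
      ((V (pt3 x1 x2 x3) ^ q1) ^ (l * α / q1) * (V (pt3 x1 x2 x3) ^ 2) ^ (l * (a / 2)) *
      (V (pt3 x1 x2 x3) ^ (5 / 2 : ℝ)) ^ (l * c2) * (V (pt3 x1 x2 x3) ^ (5 / 2 : ℝ)) ^ (l * c3)) := by
      rw [← ENNReal.rpow_natCast _ 2, ← ENNReal.rpow_natCast _ 3]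
      simp only [← ENNReal.rpow_mul]
      rw [← ENNReal.rpow_add_of_nonneg _ _ (by positivity) (by positivity),
        ← ENNReal.rpow_add_of_nonneg _ _ (by positivity) (by positivity),
        ← ENNReal.rpow_add_of_nonneg _ _ (by positivity) (by positivity),
        ← ENNReal.rpow_add_of_nonneg _ _ (by positivity) (by positivity)]
      congr 1
      rw [show q1 * (l * α / q1) = l * α by field_simp]
      push_cast
      have : a = 3 - α - b := by linarith
      rw [this]
      have h3 : c3 = b - c1 - c2 := by linarith
      rw [h3]
      linear_combination (-3) * hl1
    rw [hd]
    calc _ ≤ (K ^ (l * c1) * (∫⁻ y, h y x2 x3) ^ (l * c1)) *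
        ((f x1 x2 x3 ^ q1) ^ (l * α / q1) * (f x1 x2 x3 ^ 2) ^ (l * (a / 2)) *
        (K ^ (l * c2) * (∫⁻ y, h x1 y x3) ^ (l * c2)) *
        (K ^ (l * c3) * (∫⁻ y, h x1 x2 y) ^ (l * c3))) := by
          gcongr
      _ = _ := by
        rw [hb, mul_add, mul_add, ENNReal.rpow_add_of_nonneg _ _ (by positivity) (by positivity),
          ENNReal.rpow_add_of_nonneg _ _ (by positivity) (by positivity)]
        ring
  have hmain : N ≤ K ^ (l * b) * (A ^ (l * α) * M ^ (l * (a / 2)) *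
      (N ^ (1 / 2 : ℝ) * G ^ (1 / 2 : ℝ)) ^ (l * b)) := by
    calc N = ∫⁻ x3, ∫⁻ x2, ∫⁻ x1, V (pt3 x1 x2 x3) ^ 3 := lintegral_E3 _ (hV.pow_const 3)
      _ ≤ _ := lintegral_mono fun x3 => lintegral_mono fun x2 => lintegral_mono fun x1 =>
          hpt x1 x2 x3
      _ = K ^ (l * b) * _ := by
        have hK : K ^ (l * b) ≠ ∞ := ENNReal.rpow_ne_top_of_nonneg (by positivity) hK
        rw [← lintegral_const_mul' _ _ hK]
        refine lintegral_congr fun x3 => ?_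
        rw [← lintegral_const_mul' _ _ hK]
        refine lintegral_congr fun x2 => ?_
        rw [← lintegral_const_mul' _ _ hK]
      _ ≤ _ := by
        refine mul_le_mul_right (key.trans ?_) _
        rw [hM, ← mul_add, ← mul_add, ← hb]
        gcongr
  rcases eq_or_ne N 0 with h0 | h0
  · rw [h0]; exact bot_le
  have hsplit : N = N ^ l * N ^ (l * b / 2) := by
    rw [← ENNReal.rpow_add_of_nonneg _ _ (by positivity) (by positivity)]
    rw [show l + l * b / 2 = 1 by linarith]; simp
  have hc : N ^ l * N ^ (l * b / 2) ≤ (K ^ b * A ^ α * M ^ (a / 2) * G ^ (b / 2)) ^ l *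
      N ^ (l * b / 2) := by
    rw [← hsplit]
    refine hmain.trans (le_of_eq ?_)
    rw [ENNReal.mul_rpow_of_nonneg _ _ hl0.le, ENNReal.mul_rpow_of_nonneg _ _ hl0.le,
      ENNReal.mul_rpow_of_nonneg _ _ hl0.le, ENNReal.mul_rpow_of_nonneg _ _ (by positivity : 0 ≤ l * b)]
    simp only [← ENNReal.rpow_mul]
    rw [show (1 / 2 : ℝ) * (l * b) = l * b / 2 by ring, mul_comm b l, mul_comm α l,
      mul_comm (a / 2) l, show b / 2 * l = l * b / 2 by ring]
    ring
  have hpos : N ^ (l * b / 2) ≠ 0 := by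
    simp only [ne_eq, ENNReal.rpow_eq_zero_iff, not_or, not_and]
    exact ⟨fun h => absurd h h0, fun h => absurd h hN⟩
  have hfin : N ^ (l * b / 2) ≠ ∞ := ENNReal.rpow_ne_top_of_nonneg (by positivity) hN
  have := (ENNReal.mul_le_mul_iff_left hpos hfin).1 hc
  exact (ENNReal.rpow_le_rpow_iff hl0).1 this

lemma exists_cutoff : ∃ L : ℝ, 0 < L ∧ ∀ r R : ℝ, 0 < r → r < R → ∃ φ : E3 → ℝ, ContDiff ℝ 1 φ ∧
    (∀ x, 0 ≤ φ x ∧ φ x ≤ 1) ∧ (∀ x ∈ ball (0 : E3) r, φ x = 1) ∧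
    (∀ x, x ∉ ball (0 : E3) R → φ x = 0 ∧ fderiv ℝ φ x = 0) ∧
    ∀ x, ‖fderiv ℝ φ x‖ ≤ L / (R - r) := by
  have hS : ContDiff ℝ 1 Real.smoothTransition := Real.smoothTransition.contDiff (n := 1)
  have hcont : Continuous (deriv Real.smoothTransition) := hS.continuous_deriv le_rfl
  obtain ⟨L, hL⟩ := (isCompact_Icc (a := (0 : ℝ)) (b := 1)).exists_bound_of_continuousOn
    hcont.continuousOn
  have hL' : ∀ s, |deriv Real.smoothTransition s| ≤ max L 1 := by
    intro s
    by_cases hs : s ∈ Icc (0 : ℝ) 1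
    · exact (hL s hs).trans (le_max_left _ _)
    · have : deriv Real.smoothTransition s = 0 := by
        rw [mem_Icc, not_and_or, not_le, not_le] at hs
        rcases hs with hs | hs
        · apply IsLocalMin.deriv_eq_zero
          refine Filter.Eventually.of_forall fun y => ?_
          rw [Real.smoothTransition.zero_of_nonpos hs.le]
          exact Real.smoothTransition.nonneg y
        · apply IsLocalMax.deriv_eq_zero
          refine Filter.Eventually.of_forall fun y => ?_
          rw [Real.smoothTransition.one_of_one_le hs.le]
          exact Real.smoothTransition.le_one y
      rw [this]; simp
  refine ⟨2 * max L 1, by positivity, fun r R hr hrR => ?_⟩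
  have hD : 0 < R ^ 2 - r ^ 2 := by nlinarith
  have hin : ContDiff ℝ 1 (fun x : E3 => (R ^ 2 - ‖x‖ ^ 2) / (R ^ 2 - r ^ 2)) :=
    (contDiff_const.sub (contDiff_norm_sq ℝ)).div_const _
  have h0 : ∀ x, x ∉ ball (0 : E3) R →
      Real.smoothTransition ((R ^ 2 - ‖x‖ ^ 2) / (R ^ 2 - r ^ 2)) = 0 := by
    intro x hx
    rw [mem_ball_zero_iff, not_lt] at hx
    apply Real.smoothTransition.zero_of_nonpos
    apply div_nonpos_of_nonpos_of_nonneg _ hD.le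
    nlinarith
  have hfd : ∀ x, x ∉ ball (0 : E3) R →
      fderiv ℝ (fun x : E3 => Real.smoothTransition ((R ^ 2 - ‖x‖ ^ 2) / (R ^ 2 - r ^ 2))) x = 0 := by
    intro x hx
    apply IsLocalMin.fderiv_eq_zero
    refine Filter.Eventually.of_forall fun y => ?_
    simp only [h0 x hx]
    exact Real.smoothTransition.nonneg _
  refine ⟨fun x => Real.smoothTransition ((R ^ 2 - ‖x‖ ^ 2) / (R ^ 2 - r ^ 2)), hS.comp hin,
    fun x => ⟨Real.smoothTransition.nonneg _, Real.smoothTransition.le_one _⟩, ?_,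
    fun x hx => ⟨h0 x hx, hfd x hx⟩, ?_⟩
  · intro x hx
    rw [mem_ball_zero_iff] at hx
    apply Real.smoothTransition.one_of_one_le
    rw [one_le_div hD]
    nlinarith [norm_nonneg x]
  · intro x
    by_cases hx : x ∈ ball (0 : E3) R
    · rw [mem_ball_zero_iff] at hx
      have hd : HasFDerivAt (fun x : E3 => (R ^ 2 - ‖x‖ ^ 2) / (R ^ 2 - r ^ 2))
          ((R ^ 2 - r ^ 2)⁻¹ • (-((2 : ℕ) • innerSL ℝ x) : E3 →L[ℝ] ℝ)) x := by
        have := ((hasStrictFDerivAt_norm_sq x).hasFDerivAt.const_sub (R ^ 2)).const_mul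
          ((R ^ 2 - r ^ 2)⁻¹)
        refine this.congr_of_eventuallyEq (Filter.Eventually.of_forall fun y => ?_)
        simp only [div_eq_inv_mul]
      have hd2 := (hS.differentiable one_ne_zero
        ((R ^ 2 - ‖x‖ ^ 2) / (R ^ 2 - r ^ 2))).hasDerivAt.comp_hasFDerivAt x hd
      have : fderiv ℝ (fun x : E3 => Real.smoothTransition
        ((R ^ 2 - ‖x‖ ^ 2) / (R ^ 2 - r ^ 2))) x = _ := hd2.fderiv
      rw [this, norm_smul, norm_smul, norm_neg, Real.norm_eq_abs, Real.norm_eq_abs,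
        abs_of_pos (inv_pos.2 hD)]
      have h2 : ‖(2 : ℕ) • innerSL ℝ x‖ ≤ 2 * R := by
        rw [← Nat.cast_smul_eq_nsmul ℝ, norm_smul, innerSL_apply_norm]
        simp; exact hx.le
      have h3 : (R ^ 2 - r ^ 2)⁻¹ * (2 * R) ≤ 2 / (R - r) := by
        rw [inv_mul_eq_div, div_le_div_iff₀ hD (by linarith)]
        nlinarith [mul_pos hr (sub_pos.2 hrR)]
      calc _ ≤ max L 1 * ((R ^ 2 - r ^ 2)⁻¹ * (2 * R)) := by
            have := inv_pos.2 hD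
            gcongr
            exact hL' _
        _ ≤ max L 1 * (2 / (R - r)) := by gcongr
        _ = _ := by ring
    · rw [hfd x hx]; simp
      have : 0 < R - r := by linarith
      positivity

lemma line_bound (w : E3 → E3) (hw : ContDiff ℝ 1 w) (R : ℝ)
    (hsupp : ∀ x, x ∉ ball (0 : E3) R → w x = 0) (x0 e : E3) (he : ‖e‖ = 1) (s : ℝ) :
    ‖w (x0 + s • e)‖ₑ ^ (5 / 2 : ℝ) ≤ ENNReal.ofReal (5 / 2) *
      ∫⁻ y : ℝ, ‖w (x0 + y • e)‖ₑ ^ (3 / 2 : ℝ) * ‖fderiv ℝ w (x0 + y • e) e‖ₑ := by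
  have hγ : ∀ y : ℝ, HasDerivAt (fun y : ℝ => x0 + y • e) e y := fun y => by
    simpa using ((hasDerivAt_id y).smul_const e).const_add x0
  have hγc : ContDiff ℝ 1 (fun y : ℝ => x0 + y • e) := by fun_prop
  have hwγ : ContDiff ℝ 1 (fun y : ℝ => w (x0 + y • e)) := hw.comp hγc
  have hF : ContDiff ℝ 1 (fun y : ℝ => ‖w (x0 + y • e)‖ ^ (5 / 2 : ℝ)) :=
    hwγ.norm_rpow (by norm_num)
  have hcs : HasCompactSupport (fun y : ℝ => ‖w (x0 + y • e)‖ ^ (5 / 2 : ℝ)) := by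
    apply HasCompactSupport.intro (isCompact_closedBall (0 : ℝ) (‖x0‖ + |R|))
    intro y hy
    rw [mem_closedBall_zero_iff, not_le, Real.norm_eq_abs] at hy
    rw [hsupp, norm_zero, Real.zero_rpow (by norm_num)]
    rw [mem_ball_zero_iff, not_lt]
    have h1 : ‖y • e‖ = |y| := by rw [norm_smul, he, mul_one, Real.norm_eq_abs]
    have h2 : ‖y • e‖ ≤ ‖x0 + y • e‖ + ‖x0‖ := by
      have := norm_sub_le (x0 + y • e) x0
      simpa using this
    have := le_abs_self R
    linarith
  have hmain := hcs.enorm_le_lintegral_Ici_deriv hF s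
  have e0 : ‖w (x0 + s • e)‖ₑ ^ (5 / 2 : ℝ) = ‖‖w (x0 + s • e)‖ ^ (5 / 2 : ℝ)‖ₑ := by
    rw [Real.enorm_rpow_of_nonneg (norm_nonneg _) (by norm_num), enorm_norm]
  rw [e0]
  refine hmain.trans ((lintegral_mono' Measure.restrict_le_self le_rfl).trans ?_)
  rw [← lintegral_const_mul' _ _ ENNReal.ofReal_ne_top]
  refine lintegral_mono fun y => ?_
  have hder : HasDerivAt (fun y : ℝ => ‖w (x0 + y • e)‖ ^ (5 / 2 : ℝ))
      (((5 / 2 * ‖w (x0 + y • e)‖ ^ ((5 / 2 : ℝ) - 2)) • innerSL ℝ (w (x0 + y • e)))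
        (fderiv ℝ w (x0 + y • e) e)) y := by
    have h1 := hasFDerivAt_norm_rpow (w (x0 + y • e)) (by norm_num : (1 : ℝ) < 5 / 2)
    exact HasFDerivAt.comp_hasDerivAt (f := fun y : ℝ => w (x0 + y • e)) y h1
      ((hw.differentiable one_ne_zero _).hasFDerivAt.comp_hasDerivAt y (hγ y))
  simp only [hder.deriv]
  have hreal : ‖((5 / 2 * ‖w (x0 + y • e)‖ ^ ((5 / 2 : ℝ) - 2)) • innerSL ℝ (w (x0 + y • e)))
        (fderiv ℝ w (x0 + y • e) e)‖ ≤
      5 / 2 * (‖w (x0 + y • e)‖ ^ (3 / 2 : ℝ) * ‖fderiv ℝ w (x0 + y • e) e‖) := by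
    rw [_root_.smul_apply, norm_smul, innerSL_apply_apply, Real.norm_eq_abs,
      abs_of_nonneg (by positivity)]
    have h1 := norm_inner_le_norm (𝕜 := ℝ) (w (x0 + y • e)) (fderiv ℝ w (x0 + y • e) e)
    have h2 : ‖w (x0 + y • e)‖ ^ (3 / 2 : ℝ) =
        ‖w (x0 + y • e)‖ ^ ((5 / 2 : ℝ) - 2) * ‖w (x0 + y • e)‖ := by
      rw [← Real.rpow_add_one' (norm_nonneg _) (by norm_num)]; norm_num
    rw [h2]
    calc _ ≤ 5 / 2 * ‖w (x0 + y • e)‖ ^ ((5 / 2 : ℝ) - 2) *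
        (‖w (x0 + y • e)‖ * ‖fderiv ℝ w (x0 + y • e) e‖) := by gcongr
      _ = _ := by ring
  calc _ = ENNReal.ofReal ‖((5 / 2 * ‖w (x0 + y • e)‖ ^ ((5 / 2 : ℝ) - 2)) •
          innerSL ℝ (w (x0 + y • e))) (fderiv ℝ w (x0 + y • e) e)‖ := (ofReal_norm _).symm
    _ ≤ _ := ENNReal.ofReal_le_ofReal hreal
    _ = _ := by
      rw [ENNReal.ofReal_mul (by norm_num), ENNReal.ofReal_mul (by positivity),
        ← ENNReal.ofReal_rpow_of_nonneg (norm_nonneg _) (by norm_num), ofReal_norm, ofReal_norm]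

lemma pt3_line1 (y x2 x3 : ℝ) :
    pt3 y x2 x3 = pt3 0 x2 x3 + y • EuclideanSpace.single (0 : Fin 3) (1 : ℝ) := by
  ext i; fin_cases i <;> simp [pt3]

lemma pt3_line2 (x1 y x3 : ℝ) :
    pt3 x1 y x3 = pt3 x1 0 x3 + y • EuclideanSpace.single (1 : Fin 3) (1 : ℝ) := by
  ext i; fin_cases i <;> simp [pt3]

lemma pt3_line3 (x1 x2 y : ℝ) :
    pt3 x1 x2 y = pt3 x1 x2 0 + y • EuclideanSpace.single (2 : Fin 3) (1 : ℝ) := by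
  ext i; fin_cases i <;> simp [pt3]

lemma spatial {α a b c1 c2 c3 q1 q2 q3 : ℝ} (hα : 0 ≤ α) (ha : 0 ≤ a) (hc1 : 0 ≤ c1)
    (hc2 : 0 ≤ c2)
    (hc3 : 0 ≤ c3) (hq1 : 0 < q1) (hq2 : 0 < q2) (hq3 : 0 < q3)
    (hb : b = c1 + c2 + c3) (hab : a + b = 3 - α)
    (e1 : c1 = α / q1 - (α - 1) / 2) (e2 : c2 = α / q2 - (α - 1) / 2)
    (e3 : c3 = α / q3 - (α - 1) / 2) :
    ∃ L : ℝ, 0 < L ∧ ∀ r R : ℝ, 0 < r → r < R → ∀ u : E3 → E3, ContDiff ℝ 1 u →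
    ∫⁻ x in ball (0 : E3) r, ‖u x‖ₑ ^ 3 ≤ ENNReal.ofReal (5 / 2) ^ b *
      (anisoNorm q1 q2 q3 (ball (0 : E3) R) (fun x => ‖u x‖)) ^ α *
      (∫⁻ x in ball (0 : E3) R, ‖u x‖ₑ ^ 2) ^ (a / 2) *
      (∫⁻ x in ball (0 : E3) R, ((∑ i : Fin 3, ‖fderiv ℝ u x (EuclideanSpace.single i 1)‖ₑ) +
        ENNReal.ofReal (L / (R - r)) * ‖u x‖ₑ) ^ 2) ^ (b / 2) := by
  have hb0 : 0 ≤ b := by rw [hb]; positivity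
  obtain ⟨L, hL, hcut⟩ := exists_cutoff
  refine ⟨L, hL, fun r R hr hrR u hu => ?_⟩
  obtain ⟨φ, hφ, h01, h1, h0, hgrad⟩ := hcut r R hr hrR
  set w : E3 → E3 := fun x => φ x • u x with hw
  have hwc : ContDiff ℝ 1 w := hφ.smul hu
  have hsupp : ∀ x, x ∉ ball (0 : E3) R → w x = 0 := fun x hx => by simp [hw, (h0 x hx).1]
  have hfdu : Continuous (fderiv ℝ u) := hu.continuous_fderiv one_ne_zero
  set g0 : E3 → ℝ≥0∞ := fun x => (∑ i : Fin 3, ‖fderiv ℝ u x (EuclideanSpace.single i 1)‖ₑ) +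
        ENNReal.ofReal (L / (R - r)) * ‖u x‖ₑ with hg0
  have hg0m : Measurable g0 := by
    have hum : Measurable u := hu.continuous.measurable
    have : ∀ i : Fin 3, Measurable fun x => fderiv ℝ u x (EuclideanSpace.single i 1) := fun i =>
      (hfdu.clm_apply continuous_const).measurable
    rw [hg0]
    exact (Finset.measurable_sum _ fun i _ => (this i).enorm).add ((hum.enorm).const_mul _)
  set g : E3 → ℝ≥0∞ := (ball (0 : E3) R).indicator g0 with hg
  have hgm : Measurable g := hg0m.indicator measurableSet_ball
  -- derivative bound
  have hderiv : ∀ x (i : Fin 3), ‖fderiv ℝ w x (EuclideanSpace.single i 1)‖ₑ ≤ g x := by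
    intro x i
    have hfd : fderiv ℝ w x = φ x • fderiv ℝ u x + (fderiv ℝ φ x).smulRight (u x) :=
      fderiv_fun_smul (hφ.differentiable one_ne_zero x) (hu.differentiable one_ne_zero x)
    by_cases hx : x ∈ ball (0 : E3) R
    · rw [hg, indicator_of_mem hx, hfd]
      have hn : ‖(EuclideanSpace.single i (1 : ℝ) : E3)‖ = 1 := by simp
      have hr1 : ‖(φ x • fderiv ℝ u x + (fderiv ℝ φ x).smulRight (u x))
          (EuclideanSpace.single i 1)‖ ≤ ‖fderiv ℝ u x (EuclideanSpace.single i 1)‖ +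
          L / (R - r) * ‖u x‖ := by
        simp only [_root_.add_apply, _root_.smul_apply, ContinuousLinearMap.smulRight_apply]
        refine (norm_add_le _ _).trans ?_
        rw [norm_smul, norm_smul]
        gcongr
        · rw [Real.norm_eq_abs, abs_of_nonneg (h01 x).1]
          exact mul_le_of_le_one_left (norm_nonneg _) (h01 x).2
        · refine (ContinuousLinearMap.le_opNorm _ _).trans ?_
          rw [hn, mul_one]; exact hgrad x
      have hpos : 0 ≤ L / (R - r) := div_nonneg hL.le (by linarith)
      rw [← ofReal_norm]
      calc _ ≤ _ := ENNReal.ofReal_le_ofReal hr1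
        _ = ‖fderiv ℝ u x (EuclideanSpace.single i 1)‖ₑ +
            ENNReal.ofReal (L / (R - r)) * ‖u x‖ₑ := by
          rw [ENNReal.ofReal_add (norm_nonneg _) (by positivity), ENNReal.ofReal_mul hpos,
            ofReal_norm, ofReal_norm]
        _ ≤ _ := by
          rw [hg0]
          refine add_le_add ?_ le_rfl
          exact Finset.single_le_sum (f := fun i : Fin 3 =>
            ‖fderiv ℝ u x (EuclideanSpace.single i 1)‖ₑ) (fun _ _ => bot_le) (Finset.mem_univ i)
    · rw [hfd, (h0 x hx).1, (h0 x hx).2]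
      simp
  have hline : ∀ (x0 : E3) (i : Fin 3) (s : ℝ),
      ‖w (x0 + s • EuclideanSpace.single i (1 : ℝ))‖ₑ ^ (5 / 2 : ℝ) ≤ ENNReal.ofReal (5 / 2) *
      ∫⁻ y : ℝ, ‖w (x0 + y • EuclideanSpace.single i (1 : ℝ))‖ₑ ^ (3 / 2 : ℝ) *
        g (x0 + y • EuclideanSpace.single i (1 : ℝ)) := by
    intro x0 i s
    refine (line_bound w hwc R hsupp x0 (EuclideanSpace.single i 1) (by simp) s).trans ?_
    gcongr
    exact hderiv _ i
  have hfin : ∫⁻ x, ‖w x‖ₑ ^ 3 ≠ ∞ := by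
    have hcs : HasCompactSupport (fun x => ‖w x‖ ^ 3) := by
      apply HasCompactSupport.intro (isCompact_closedBall (0 : E3) R)
      intro x hx
      rw [hsupp x (fun h => hx (ball_subset_closedBall h))]
      simp
    have hwint : Integrable (fun x => ‖w x‖ ^ 3) :=
      (hwc.continuous.norm.pow 3).integrable_of_hasCompactSupport hcs
    have := hwint.hasFiniteIntegral
    rw [HasFiniteIntegral] at this
    simpa [enorm_pow] using this.ne
  have hmain := spatial_abs (fun x => ‖w x‖ₑ) g hwc.continuous.measurable.enorm hgm hα ha hc1 hc2
    hc3 hq1 hq2 hq3 hb hab e1 e2 e3 (ENNReal.ofReal (5 / 2)) ENNReal.ofReal_ne_top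
    (fun x1 x2 x3 => by
      simpa only [← pt3_line1] using hline (pt3 0 x2 x3) 0 x1)
    (fun x1 x2 x3 => by
      simpa only [← pt3_line2] using hline (pt3 x1 0 x3) 1 x2)
    (fun x1 x2 x3 => by
      simpa only [← pt3_line3] using hline (pt3 x1 x2 0) 2 x3) hfin
  have hle : ∀ x, ‖w x‖ₑ ≤ (ball (0 : E3) R).indicator (fun x => ‖u x‖ₑ) x := by
    intro x
    by_cases hx : x ∈ ball (0 : E3) R
    · rw [indicator_of_mem hx, hw]
      simp only [enorm_smul]
      refine mul_le_of_le_one_left bot_le ?_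
      rw [← ofReal_norm, Real.norm_eq_abs, abs_of_nonneg (h01 x).1]
      exact ENNReal.ofReal_le_one.2 (h01 x).2
    · rw [hsupp x hx]; simp
  have hleft : ∫⁻ x in ball (0 : E3) r, ‖u x‖ₑ ^ 3 ≤ ∫⁻ x, ‖w x‖ₑ ^ 3 := by
    rw [← lintegral_indicator measurableSet_ball]
    refine lintegral_mono fun x => ?_
    by_cases hx : x ∈ ball (0 : E3) r
    · simp only [indicator_of_mem hx, hw, h1 x hx, one_smul]; exact le_rfl
    · simp only [indicator_of_notMem hx]; exact bot_le
  have hA : (∫⁻ x3, (∫⁻ x2, (∫⁻ x1, ‖w (pt3 x1 x2 x3)‖ₑ ^ q1) ^ (q2 / q1)) ^ (q3 / q2)) ^ (1 / q3) ≤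
      anisoNorm q1 q2 q3 (ball (0 : E3) R) (fun x => ‖u x‖) := by
    unfold anisoNorm
    gcongr with x3 x2 x1
    refine (hle _).trans (le_of_eq ?_)
    by_cases hx : pt3 x1 x2 x3 ∈ ball (0 : E3) R
    · simp only [indicator_of_mem hx, abs_norm, ofReal_norm]
    · simp only [indicator_of_notMem hx]; simp
  have hM : ∫⁻ x, ‖w x‖ₑ ^ 2 ≤ ∫⁻ x in ball (0 : E3) R, ‖u x‖ₑ ^ 2 := by
    rw [← lintegral_indicator measurableSet_ball]
    refine lintegral_mono fun x => ?_
    refine (pow_le_pow_left' (hle x) 2).trans (le_of_eq ?_)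
    by_cases hx : x ∈ ball (0 : E3) R
    · simp only [indicator_of_mem hx]
    · simp only [indicator_of_notMem hx]; simp
  have hG : ∫⁻ x, g x ^ 2 = ∫⁻ x in ball (0 : E3) R, g0 x ^ 2 := by
    rw [← lintegral_indicator measurableSet_ball]
    refine lintegral_congr fun x => ?_
    by_cases hx : x ∈ ball (0 : E3) R
    · simp only [hg, indicator_of_mem hx]
    · simp only [hg, indicator_of_notMem hx]; simp
  rw [hG] at hmain
  refine hleft.trans (hmain.trans ?_)
  gcongr

lemma add_rpow_le2 (x y : ℝ≥0∞) {s : ℝ} (hs : 0 ≤ s) :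
    (x + y) ^ s ≤ 2 ^ s * (x ^ s + y ^ s) := by
  have h : x + y ≤ 2 * max x y := by
    rw [two_mul]; exact add_le_add (le_max_left _ _) (le_max_right _ _)
  calc (x + y) ^ s ≤ (2 * max x y) ^ s := ENNReal.rpow_le_rpow h hs
    _ = 2 ^ s * (max x y) ^ s := ENNReal.mul_rpow_of_nonneg _ _ hs
    _ ≤ _ := by
      gcongr
      rcases max_cases x y with h | h <;> rw [h.1]
      · exact le_self_add
      · exact le_add_self

lemma mul_rpow_le_add (x y : ℝ≥0∞) {s t : ℝ} (hs : 0 ≤ s) (ht : 0 ≤ t) :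
    x ^ s * y ^ t ≤ x ^ (s + t) + y ^ (s + t) := by
  calc x ^ s * y ^ t ≤ (max x y) ^ s * (max x y) ^ t := by
        gcongr
        · exact le_max_left _ _
        · exact le_max_right _ _
    _ = (max x y) ^ (s + t) := (ENNReal.rpow_add_of_nonneg _ _ hs ht).symm
    _ ≤ _ := by
      rcases max_cases x y with h | h <;> rw [h.1]
      · exact le_self_add
      · exact le_add_self

lemma time_holder (μ : Measure ℝ) (A D : ℝ → ℝ≥0∞) (hA : Measurable A) (hD : Measurable D)
    (p : ℝ≥0∞) (hp : 1 ≤ p) {α s θ : ℝ} (hα : 0 ≤ α) (hs : 0 ≤ s) (hθ : 0 ≤ θ)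
    (hsum : α / p.toReal + s + θ = 1) :
    ∫⁻ t, A t ^ α * D t ^ s ∂μ ≤
      (if p = ∞ then essSup A μ else (∫⁻ t, A t ^ p.toReal ∂μ) ^ (1 / p.toReal)) ^ α *
        (∫⁻ t, D t ∂μ) ^ s * (μ univ) ^ θ := by
  by_cases hpt : p = ∞
  · subst hpt
    rw [ENNReal.toReal_top, _root_.div_zero, zero_add] at hsum
    simp only [if_true]
    calc _ ≤ ∫⁻ t, (essSup A μ) ^ α * (D t ^ s * (1 : ℝ≥0∞) ^ θ) ∂μ := by
          apply lintegral_mono_ae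
          filter_upwards [ENNReal.ae_le_essSup A] with t ht
          rw [ENNReal.one_rpow, mul_one]
          gcongr
      _ = (essSup A μ) ^ α * ∫⁻ t, (D t ^ s * (1 : ℝ≥0∞) ^ θ) ∂μ :=
          lintegral_const_mul _ (by fun_prop)
      _ ≤ (essSup A μ) ^ α * ((∫⁻ t, D t ∂μ) ^ s * (∫⁻ t, 1 ∂μ) ^ θ) := by
          gcongr
          exact ENNReal.lintegral_mul_norm_pow_le hD.aemeasurable aemeasurable_const hs hθ hsum
      _ = _ := by rw [lintegral_one]; ring
  · rw [if_neg hpt]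
    have hp0 : 0 < p.toReal := ENNReal.toReal_pos (by positivity) hpt
    have := ENNReal.lintegral_prod_norm_pow_le (μ := μ) (Finset.univ : Finset (Fin 3))
      (f := ![fun t => A t ^ p.toReal, D, fun _ => 1]) (p := ![α / p.toReal, s, θ])
      (by intro i _; fin_cases i <;> simp <;> fun_prop)
      (by simp [Fin.sum_univ_three]; linarith)
      (by intro i _; fin_cases i <;> simp <;> first | assumption | positivity)
    simp only [Fin.prod_univ_three, Matrix.cons_val_zero, Matrix.cons_val_one, Matrix.cons_val,
      ENNReal.one_rpow, mul_one, lintegral_one, ← ENNReal.rpow_mul] at this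
    rw [← ENNReal.rpow_mul]
    have e1 : p.toReal * (α / p.toReal) = α := by field_simp
    have e2 : 1 / p.toReal * α = α / p.toReal := by ring
    rw [e1] at this
    rw [e2]
    exact this

lemma measurable_aniso (q1 q2 q3 R : ℝ) (u : E3 → ℝ → E3) (hu : Measurable (Function.uncurry u)) :
    Measurable (fun t => anisoNorm q1 q2 q3 (ball (0 : E3) R) (fun x => ‖u x t‖)) := by
  unfold anisoNorm
  have h0 : Measurable (fun z : E3 × ℝ =>
      ENNReal.ofReal |(ball (0 : E3) R).indicator (fun x => ‖u x z.2‖) z.1|) := by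
    have : (fun z : E3 × ℝ => (ball (0 : E3) R).indicator (fun x => ‖u x z.2‖) z.1) =
        (Prod.fst ⁻¹' (ball (0 : E3) R)).indicator (fun z : E3 × ℝ => ‖u z.1 z.2‖) := by
      ext z
      simp [indicator]
    have h1 : Measurable (fun z : E3 × ℝ =>
        (ball (0 : E3) R).indicator (fun x => ‖u x z.2‖) z.1) := by
      rw [this]
      exact Measurable.indicator hu.norm (measurable_fst measurableSet_ball)
    exact ENNReal.measurable_ofReal.comp (measurable_norm.comp h1)
  have h1 : Measurable (fun w : ((ℝ × ℝ) × ℝ) × ℝ => (ENNReal.ofReal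
      |(ball (0 : E3) R).indicator (fun x => ‖u x w.1.1.1‖) (pt3 w.2 w.1.2 w.1.1.2)|) ^ q1) := by
    have : Measurable (fun w : ((ℝ × ℝ) × ℝ) × ℝ => ((pt3 w.2 w.1.2 w.1.1.2 : E3), w.1.1.1)) :=
      (measurable_pt3.comp (f := fun w : ((ℝ × ℝ) × ℝ) × ℝ => (w.2, w.1.2, w.1.1.2))
        (by fun_prop)).prodMk (by fun_prop)
    exact (h0.comp this).pow_const q1
  have h2 := (Measurable.lintegral_prod_right' (ν := (volume : Measure ℝ)) h1).pow_const (q2 / q1)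
  have h3 := (Measurable.lintegral_prod_right' (ν := (volume : Measure ℝ)) h2).pow_const (q3 / q2)
  exact (Measurable.lintegral_prod_right' (ν := (volume : Measure ℝ)) h3).pow_const (1 / q3)

lemma measurable_pderiv (u : E3 → ℝ → E3) (hu : Measurable (Function.uncurry u))
    (hd : ∀ t, Differentiable ℝ (fun x => u x t)) (e : E3) :
    Measurable (fun z : ℝ × E3 => fderiv ℝ (fun y => u y z.1) z.2 e) := by
  have hlim : ∀ z : ℝ × E3, Tendsto (fun n : ℕ => ((n : ℝ) + 1) •
      (u (z.2 + ((n : ℝ) + 1)⁻¹ • e) z.1 - u z.2 z.1)) atTop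
      (nhds (fderiv ℝ (fun y => u y z.1) z.2 e)) := by
    intro z
    have hl := ((hd z.1 z.2).hasFDerivAt.hasLineDerivAt e).tendsto_slope_zero_right
    have hseq : Tendsto (fun n : ℕ => ((n : ℝ) + 1)⁻¹) atTop (nhdsWithin 0 (Ioi 0)) := by
      rw [tendsto_nhdsWithin_iff]
      refine ⟨?_, Filter.Eventually.of_forall fun n => by simp; positivity⟩
      simpa [one_div] using tendsto_one_div_add_atTop_nhds_zero_nat (𝕜 := ℝ)
    have := hl.comp hseq
    refine this.congr fun n => ?_
    simp
  refine measurable_of_tendsto_metrizable (fun n => ?_) (tendsto_pi_nhds.2 hlim)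
  have m1 : Measurable (fun z : ℝ × E3 => u (z.2 + ((n : ℝ) + 1)⁻¹ • e) z.1) :=
    hu.comp (f := fun z : ℝ × E3 => (z.2 + ((n : ℝ) + 1)⁻¹ • e, z.1)) (by fun_prop)
  have m2 : Measurable (fun z : ℝ × E3 => u z.2 z.1) :=
    hu.comp (f := fun z : ℝ × E3 => (z.2, z.1)) (by fun_prop)
  exact (m1.sub m2).const_smul ((n : ℝ) + 1)

lemma lem_split (B : Set E3) (g v : E3 → ℝ≥0∞) (hg : Measurable g) (k : ℝ≥0∞) {b : ℝ}
    (hk : k ≠ ∞) (hb : 0 ≤ b) :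
    (∫⁻ x in B, (g x + k * v x) ^ 2) ^ (b / 2) ≤
      (4 ^ (b / 2) * 2 ^ (b / 2)) * ((∫⁻ x in B, g x ^ 2) ^ (b / 2) +
        k ^ b * (∫⁻ x in B, v x ^ 2) ^ (b / 2)) := by
  have h1 : ∫⁻ x in B, (g x + k * v x) ^ 2 ≤
      4 * ((∫⁻ x in B, g x ^ 2) + k ^ 2 * ∫⁻ x in B, v x ^ 2) := by
    rw [← lintegral_const_mul' _ _ (by finiteness), ← lintegral_add_left (hg.pow_const 2),
      ← lintegral_const_mul' _ _ (by finiteness)]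
    refine lintegral_mono fun x => ?_
    have := add_rpow_le2 (g x) (k * v x) (s := 2) (by norm_num)
    simp only [ENNReal.rpow_two, mul_pow] at this
    refine this.trans (le_of_eq ?_)
    norm_num
  calc _ ≤ (4 * ((∫⁻ x in B, g x ^ 2) + k ^ 2 * ∫⁻ x in B, v x ^ 2)) ^ (b / 2) :=
        ENNReal.rpow_le_rpow h1 (by positivity)
    _ = 4 ^ (b / 2) * ((∫⁻ x in B, g x ^ 2) + k ^ 2 * ∫⁻ x in B, v x ^ 2) ^ (b / 2) :=
        ENNReal.mul_rpow_of_nonneg _ _ (by positivity)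
    _ ≤ 4 ^ (b / 2) * (2 ^ (b / 2) * ((∫⁻ x in B, g x ^ 2) ^ (b / 2) +
        (k ^ 2 * ∫⁻ x in B, v x ^ 2) ^ (b / 2))) := by
        gcongr
        exact add_rpow_le2 _ _ (by positivity)
    _ = _ := by
        rw [ENNReal.mul_rpow_of_nonneg _ _ (by positivity : 0 ≤ b / 2), ← ENNReal.rpow_two,
          ← ENNReal.rpow_mul, show 2 * (b / 2) = b by ring]
        ring

/-- Lemma 4.1: with `α = 2/(2/p + 1/q̄) > 1`, `q_j ≤ 2α/(α−1)` and `7 − 3α − 4α/p ≥ 0`,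
for `0 < ξ < η` and `ϱ = (ξ+3η)/4`:
`‖u‖³_{L³(Q(ϱ))} ≤ C η^{3(α−1)/2} ‖u‖^α_{LᵖLq⃗(Q(η))}
  { [1 + η^{(7−3α−4α/p)/2}/(η−ϱ)^{(7−3α−4α/p)/2}] ‖u‖^{3−α}_{L^∞L²(Q(η))}
    + ‖∇u‖^{3−α}_{L²(Q(η))} }`. -/
theorem lemma_cube_one_scale
    (p : ℝ≥0∞) (q1 q2 q3 α : ℝ) (hp : 1 ≤ p)
    (hq1 : 1 < q1) (hq2 : 1 < q2) (hq3 : 1 < q3)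
    (hα : α = 2 / (2 / p.toReal + (1/q1 + 1/q2 + 1/q3)))
    (hα1 : 1 < α)
    (hqa1 : q1 ≤ 2*α/(α-1)) (hqa2 : q2 ≤ 2*α/(α-1)) (hqa3 : q3 ≤ 2*α/(α-1))
    (h7 : 0 ≤ 7 - 3*α - 4*α/p.toReal) :
    ∃ C : ℝ, 0 < C ∧
      ∀ (ξ η : ℝ), 0 < ξ → ξ < η → ∀ u : E3 → ℝ → E3,
        Measurable (Function.uncurry u) →
        (∀ t : ℝ, ContDiff ℝ (⊤ : ℕ∞) (fun x => u x t)) →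
        (∫⁻ t in Ioo (-(((ξ + 3*η)/4)^2)) 0, ∫⁻ x in ball (0 : E3) ((ξ + 3*η)/4),
            ((‖u x t‖₊ : ℝ≥0∞)) ^ 3)
          ≤ ENNReal.ofReal C * ENNReal.ofReal (η ^ (3*(α-1)/2))
              * (mixedNorm p q1 q2 q3 η (fun x t => ‖u x t‖)) ^ α
              * ((1 + ENNReal.ofReal
                      (η ^ ((7 - 3*α - 4*α/p.toReal)/2)
                        / (η - (ξ + 3*η)/4) ^ ((7 - 3*α - 4*α/p.toReal)/2)))
                  * (essSup (fun t => l2On (ball (0 : E3) η) (fun x => ‖u x t‖))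
                        (volume.restrict (Ioo (-(η^2)) 0))) ^ (3 - α)
                + ((∫⁻ t in Ioo (-(η^2)) 0, ∫⁻ x in ball (0 : E3) η,
                      (ENNReal.ofReal ‖fderiv ℝ (fun y => u y t) x‖) ^ 2) ^ ((1:ℝ)/2))
                    ^ (3 - α)) := by
  have hp' : 0 ≤ p.toReal := ENNReal.toReal_nonneg
  have hq1' : 0 < q1 := by linarith
  have hq2' : 0 < q2 := by linarith
  have hq3' : 0 < q3 := by linarith
  have hα0 : 0 < α := by linarith
  have hαm : 0 < α - 1 := by linarith
  have hrel : 2 * (α / p.toReal) + (α / q1 + α / q2 + α / q3) = 2 := by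
    have hden : 2 / p.toReal + (1/q1 + 1/q2 + 1/q3) ≠ 0 := by
      intro h
      rw [h] at hα
      simp at hα
      linarith
    rw [eq_div_iff hden] at hα
    linear_combination hα
  have hc : ∀ q : ℝ, 0 < q → q ≤ 2*α/(α-1) → 0 ≤ α / q - (α - 1) / 2 := by
    intro q hq h
    rw [le_div_iff₀ hαm] at h
    rw [sub_nonneg, div_le_div_iff₀ (by norm_num) hq]
    linarith
  have hP : 0 ≤ α / p.toReal := by positivity
  set b : ℝ := (7 - 3*α - 4*α/p.toReal)/2 with hb
  have hb0 : 0 ≤ b := by rw [hb]; linarith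
  have hbP : b = (7 - 3 * α - 4 * (α / p.toReal)) / 2 := by rw [hb]; ring
  set a : ℝ := (α - 1) / 2 + 2 * (α / p.toReal) with ha
  have ha0 : 0 ≤ a := by positivity
  have hab : a + b = 3 - α := by rw [hbP, ha]; ring
  obtain ⟨L, hL, hsp⟩ := spatial (α := α) (a := a) (b := b) hα0.le ha0 (hc q1 hq1' hqa1)
    (hc q2 hq2' hqa2) (hc q3 hq3' hqa3) hq1' hq2' hq3'
    (by rw [hbP]; linarith) hab rfl rfl rfl
  set C1 : ℝ≥0∞ := ENNReal.ofReal (5 / 2) ^ b * (4 ^ (b / 2) * 2 ^ (b / 2)) with hC1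
  have hC1t : C1 ≠ ∞ := by
    rw [hC1]
    have h1 := ENNReal.rpow_ne_top_of_nonneg hb0 (ENNReal.ofReal_ne_top (r := 5 / 2))
    have h2 := ENNReal.rpow_ne_top_of_nonneg (by positivity : 0 ≤ b / 2) (by finiteness : (4 : ℝ≥0∞) ≠ ∞)
    have h3 := ENNReal.rpow_ne_top_of_nonneg (by positivity : 0 ≤ b / 2) (by finiteness : (2 : ℝ≥0∞) ≠ ∞)
    exact ENNReal.mul_ne_top h1 (ENNReal.mul_ne_top h2 h3)
  set C2 : ℝ≥0∞ := C1 * (9 ^ (b / 2) + ENNReal.ofReal (L ^ b)) with hC2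
  have hC2t : C2 ≠ ∞ := by
    have h2 := ENNReal.rpow_ne_top_of_nonneg (by positivity : 0 ≤ b / 2) (by finiteness : (9 : ℝ≥0∞) ≠ ∞)
    exact ENNReal.mul_ne_top hC1t (ENNReal.add_ne_top.2 ⟨h2, ENNReal.ofReal_ne_top⟩)
  refine ⟨C2.toReal + 1, by positivity, ?_⟩
  intro ξ η hξ hξη u hum hus
  have hη : 0 < η := hξ.trans hξη
  set r : ℝ := (ξ + 3*η)/4 with hr
  have hr0 : 0 < r := by rw [hr]; linarith
  have hrη : r < η := by rw [hr]; linarith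
  have hu1 : ∀ t, ContDiff ℝ 1 (fun x => u x t) := fun t => (hus t).of_le (by exact_mod_cast le_top)
  -- abbreviations
  set B := ball (0 : E3) η with hB
  set A : ℝ → ℝ≥0∞ := fun t => anisoNorm q1 q2 q3 B (fun x => ‖u x t‖) with hA
  set M : ℝ → ℝ≥0∞ := fun t => ∫⁻ x in B, ‖u x t‖ₑ ^ 2 with hM
  set D : ℝ → ℝ≥0∞ := fun t => ∫⁻ x in B,
    (∑ i : Fin 3, ‖fderiv ℝ (fun y => u y t) x (EuclideanSpace.single i 1)‖ₑ) ^ 2 with hD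
  set μ : Measure ℝ := volume.restrict (Ioo (-(η^2)) 0) with hμ
  set Mb : ℝ≥0∞ := essSup (fun t => l2On B (fun x => ‖u x t‖)) μ with hMb
  set Db : ℝ≥0∞ := (∫⁻ t, (∫⁻ x in B,
    (ENNReal.ofReal ‖fderiv ℝ (fun y => u y t) x‖) ^ 2) ∂μ) ^ ((1:ℝ)/2) with hDb
  have hAmix : mixedNorm p q1 q2 q3 η (fun x t => ‖u x t‖) =
      (if p = ∞ then essSup A μ else (∫⁻ t, A t ^ p.toReal ∂μ) ^ (1 / p.toReal)) := rfl
  set Ab : ℝ≥0∞ := mixedNorm p q1 q2 q3 η (fun x t => ‖u x t‖) with hAb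
  set k : ℝ≥0∞ := ENNReal.ofReal (L / (η - r)) with hk
  have hAm : Measurable A := measurable_aniso q1 q2 q3 η u hum
  have hpm : ∀ i : Fin 3, Measurable (fun z : ℝ × E3 =>
      fderiv ℝ (fun y => u y z.1) z.2 (EuclideanSpace.single i 1)) := fun i =>
    measurable_pderiv u hum (fun t => (hu1 t).differentiable one_ne_zero) _
  have hDm : Measurable D := by
    have : Measurable (fun z : ℝ × E3 => (∑ i : Fin 3,
        ‖fderiv ℝ (fun y => u y z.1) z.2 (EuclideanSpace.single i 1)‖ₑ) ^ 2) :=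
      (Finset.measurable_sum _ fun i _ => (hpm i).enorm).pow_const 2
    exact this.lintegral_prod_right'
  -- pointwise in time
  have hpt : ∀ t, ∫⁻ x in ball (0 : E3) r, ‖u x t‖ₑ ^ 3 ≤
      C1 * (A t ^ α * M t ^ (a / 2) * (D t ^ (b / 2) + k ^ b * M t ^ (b / 2))) := by
    intro t
    refine (hsp r η hr0 hrη (fun x => u x t) (hu1 t)).trans ?_
    have h1 := lem_split B (fun x => ∑ i : Fin 3,
        ‖fderiv ℝ (fun y => u y t) x (EuclideanSpace.single i 1)‖ₑ) (fun x => ‖u x t‖ₑ)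
        (Finset.measurable_sum _ fun i _ => ((hpm i).comp
          (f := fun x : E3 => (t, x)) (by fun_prop)).enorm) k ENNReal.ofReal_ne_top hb0
    refine (mul_le_mul_right h1 _).trans (le_of_eq ?_)
    rw [hC1]
    ring
  have hl2 : ∀ t, l2On B (fun x => ‖u x t‖) = M t ^ (1 / 2 : ℝ) := by
    intro t
    simp only [l2On, hM, abs_norm, ofReal_norm]
  have hMle : ∀ᵐ t ∂μ, M t ^ (1 / 2 : ℝ) ≤ Mb := by
    filter_upwards [ENNReal.ae_le_essSup (μ := μ) (fun t => l2On B (fun x => ‖u x t‖))] with t ht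
    rw [← hl2 t]; exact ht
  have hbd : ∀ᵐ t ∂μ, ∫⁻ x in ball (0 : E3) r, ‖u x t‖ₑ ^ 3 ≤
      C1 * (Mb ^ a * (A t ^ α * D t ^ (b / 2)) + k ^ b * Mb ^ (a + b) * (A t ^ α * D t ^ (0 : ℝ))) := by
    filter_upwards [hMle] with t ht
    refine (hpt t).trans ?_
    have k1 : M t ^ (a / 2) ≤ Mb ^ a := by
      have := ENNReal.rpow_le_rpow ht ha0
      rwa [← ENNReal.rpow_mul, show 1 / 2 * a = a / 2 by ring] at this
    have k2 : M t ^ (b / 2) ≤ Mb ^ b := by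
      have := ENNReal.rpow_le_rpow ht hb0
      rwa [← ENNReal.rpow_mul, show 1 / 2 * b = b / 2 by ring] at this
    refine mul_le_mul_right ?_ _
    calc _ ≤ A t ^ α * Mb ^ a * (D t ^ (b / 2) + k ^ b * Mb ^ b) := by gcongr
      _ = _ := by
        rw [ENNReal.rpow_zero, ENNReal.rpow_add_of_nonneg _ _ ha0 hb0]; ring
  have hvol : μ univ = ENNReal.ofReal (η ^ 2) := by
    rw [hμ, Measure.restrict_apply_univ, Real.volume_Ioo]; congr 1; ring
  have hvolp : ∀ θ : ℝ, (μ univ) ^ θ = ENNReal.ofReal (η ^ (2 * θ)) := by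
    intro θ
    rw [hvol, ENNReal.ofReal_rpow_of_pos (by positivity), ← Real.rpow_natCast, ← Real.rpow_mul hη.le]
    norm_num
  have t1 := time_holder μ A D hAm hDm p hp (α := α) (s := b / 2) (θ := 3 * (α - 1) / 4) hα0.le
    (by positivity) (by positivity) (by rw [hbP]; ring)
  have t2 := time_holder μ A D hAm hDm p hp (α := α) (s := 0) (θ := 3 * (α - 1) / 4 + b / 2) hα0.le
    le_rfl (by positivity) (by rw [hbP]; ring)
  rw [← hAmix, hvolp] at t1 t2
  rw [ENNReal.rpow_zero, mul_one] at t2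
  have hDD : (∫⁻ t, D t ∂μ) ^ (b / 2) ≤ 9 ^ (b / 2) * Db ^ b := by
    have : ∫⁻ t, D t ∂μ ≤ 9 * ∫⁻ t, (∫⁻ x in B,
        (ENNReal.ofReal ‖fderiv ℝ (fun y => u y t) x‖) ^ 2) ∂μ := by
      rw [← lintegral_const_mul' _ _ (by finiteness)]
      refine lintegral_mono fun t => ?_
      rw [← lintegral_const_mul' _ _ (by finiteness)]
      refine lintegral_mono fun x => ?_
      have h3 : ∑ i : Fin 3, ‖fderiv ℝ (fun y => u y t) x (EuclideanSpace.single i 1)‖ₑ ≤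
          3 * ENNReal.ofReal ‖fderiv ℝ (fun y => u y t) x‖ := by
        calc _ ≤ ∑ i : Fin 3, ENNReal.ofReal ‖fderiv ℝ (fun y => u y t) x‖ := by
              refine Finset.sum_le_sum fun i _ => ?_
              rw [← ofReal_norm]
              refine ENNReal.ofReal_le_ofReal ((ContinuousLinearMap.le_opNorm _ _).trans ?_)
              simp
          _ = _ := by simp
      refine (pow_le_pow_left' h3 2).trans (le_of_eq ?_)
      rw [mul_pow]; norm_num
    refine (ENNReal.rpow_le_rpow this (by positivity)).trans (le_of_eq ?_)
    rw [ENNReal.mul_rpow_of_nonneg _ _ (by positivity), hDb, ← ENNReal.rpow_mul,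
      show 1 / 2 * b = b / 2 by ring]
  have hsub : ∫⁻ t in Ioo (-(r^2)) 0, ∫⁻ x in ball (0 : E3) r, ‖u x t‖ₑ ^ 3 ≤
      ∫⁻ t, (∫⁻ x in ball (0 : E3) r, ‖u x t‖ₑ ^ 3) ∂μ := by
    refine lintegral_mono_set (Ioo_subset_Ioo_left ?_)
    nlinarith
  have hη2 : ENNReal.ofReal (η ^ (2 * (3 * (α - 1) / 4 + b / 2))) =
      ENNReal.ofReal (η ^ (3 * (α - 1) / 2)) * ENNReal.ofReal (η ^ b) := by
    rw [← ENNReal.ofReal_mul (by positivity), ← Real.rpow_add hη]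
    congr 2; ring
  have hη1 : 2 * (3 * (α - 1) / 4) = 3 * (α - 1) / 2 := by ring
  have hkb : k ^ b * ENNReal.ofReal (η ^ b) =
      ENNReal.ofReal (L ^ b) * ENNReal.ofReal (η ^ b / (η - r) ^ b) := by
    have hpos : 0 < η - r := by linarith
    rw [hk, ENNReal.ofReal_rpow_of_pos (by positivity), ← ENNReal.ofReal_mul (by positivity),
      ← ENNReal.ofReal_mul (by positivity), Real.div_rpow hL.le hpos.le]
    congr 1; ring
  rw [hη1] at t1
  rw [hη2] at t2
  set Y := ENNReal.ofReal (η ^ (3 * (α - 1) / 2)) with hY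
  set Z := ENNReal.ofReal (η ^ b / (η - r) ^ b) with hZ
  have hC : C2 ≤ ENNReal.ofReal (C2.toReal + 1) := by
    rw [ENNReal.le_ofReal_iff_toReal_le hC2t (by positivity)]; linarith
  have hmb : Mb ^ a * Db ^ b ≤ Mb ^ (3 - α) + Db ^ (3 - α) := by
    rw [← hab]; exact mul_rpow_le_add _ _ ha0 hb0
  rw [hab] at hbd
  have hAD : ∀ s : ℝ, Measurable fun t => A t ^ α * D t ^ s := fun s =>
    (hAm.pow_const _).mul (hDm.pow_const _)
  calc _ ≤ ∫⁻ t, (∫⁻ x in ball (0 : E3) r, ‖u x t‖ₑ ^ 3) ∂μ := hsub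
    _ ≤ _ := lintegral_mono_ae hbd
    _ = C1 * (Mb ^ a * (∫⁻ t, A t ^ α * D t ^ (b / 2) ∂μ) +
          k ^ b * Mb ^ (3 - α) * (∫⁻ t, A t ^ α * D t ^ (0 : ℝ) ∂μ)) := by
        rw [lintegral_const_mul' _ _ hC1t, lintegral_add_left ((hAD _).const_mul _),
          lintegral_const_mul _ (hAD _), lintegral_const_mul _ (hAD _)]
    _ ≤ C1 * (Mb ^ a * (Ab ^ α * (9 ^ (b / 2) * Db ^ b) * Y) +
          k ^ b * Mb ^ (3 - α) * (Ab ^ α * (Y * ENNReal.ofReal (η ^ b)))) := by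
        gcongr
        exact t1.trans (by gcongr)
    _ = C1 * (Y * Ab ^ α * (9 ^ (b / 2) * (Mb ^ a * Db ^ b) +
          (k ^ b * ENNReal.ofReal (η ^ b)) * Mb ^ (3 - α))) := by ring
    _ ≤ C1 * (Y * Ab ^ α * (9 ^ (b / 2) * (Mb ^ (3 - α) + Db ^ (3 - α)) +
          (ENNReal.ofReal (L ^ b) * Z) * Mb ^ (3 - α))) := by
        rw [hkb]; gcongr
    _ ≤ C1 * (Y * Ab ^ α * ((9 ^ (b / 2) + ENNReal.ofReal (L ^ b)) *
          ((1 + Z) * Mb ^ (3 - α) + Db ^ (3 - α)))) := by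
        gcongr
        have : (9 ^ (b / 2) + ENNReal.ofReal (L ^ b)) * ((1 + Z) * Mb ^ (3 - α) + Db ^ (3 - α)) =
          (9 ^ (b / 2) * (Mb ^ (3 - α) + Db ^ (3 - α)) +
          (ENNReal.ofReal (L ^ b) * Z) * Mb ^ (3 - α)) + (9 ^ (b / 2) * Z * Mb ^ (3 - α) +
          ENNReal.ofReal (L ^ b) * (Mb ^ (3 - α) + Db ^ (3 - α))) := by ring
        rw [this]
        exact le_self_add
    _ = C2 * Y * Ab ^ α * ((1 + Z) * Mb ^ (3 - α) + Db ^ (3 - α)) := by rw [hC2]; ring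
    _ ≤ _ := by gcongr
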